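/- The Poisson bracket on Fun(G_μ) defined by the Sklyanin bracket of r = w(J∧P₁ + D∧P₂) with the given left and right invariant vector fields satisfies the Jacobi identity; in particular, for the coordinate functions the brackets {d,p₁} = wμe^d S_{-μ}(θ), {d,p₂} = w(e^d C_{-μ}(θ)-1), {θ,p₁} = w(e^d C_{-μ}(θ)-1), {θ,p₂} = we^d S_{-μ}(θ), {p₁,c₁} = wμc₂, {p₁,c₂} = wc₁, {p₂,c₁} = -wc₁, {p₂,c₂} = -wc₂ (all other brackets among {θ,d,p₁,p₂,c₁,c₂} zero) satisfy the Jacobi identity {x,{y,z}} + {y,{z,x}} + {z,{x,y}} = 0 for all triples of coordinate functions. -/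

import Mathlib

/-!
Coordinates on the group G_μ: q 0 = θ, q 1 = d, q 2 = p₁, q 3 = p₂,
q 4 = c₁, q 5 = c₂, for q : Fin 6 → ℝ.
-/

/-- C_{-μ}(θ) = cosh(√μ θ). -/
noncomputable def pbC (μ θ : ℝ) : ℝ := Real.cosh (Real.sqrt μ * θ)

/-- S_{-μ}(θ) = sinh(√μ θ)/√μ. -/
noncomputable def pbS (μ θ : ℝ) : ℝ := Real.sinh (Real.sqrt μ * θ) / Real.sqrt μ

/-- Upper-triangular part of the Poisson bivector on Fun(G_μ), from the
fundamental brackets {θ,p₁}, {θ,p₂}, {d,p₁}, {d,p₂}, {p₁,c₁}, {p₁,c₂},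
{p₂,c₁}, {p₂,c₂} of the paper. -/
noncomputable def pbUpper (μ w : ℝ) : Fin 6 → Fin 6 → (Fin 6 → ℝ) → ℝ :=
  ![![fun _ => 0, fun _ => 0,
      fun q => w * (Real.exp (q 1) * pbC μ (q 0) - 1),
      fun q => w * Real.exp (q 1) * pbS μ (q 0), fun _ => 0, fun _ => 0],
    ![fun _ => 0, fun _ => 0,
      fun q => w * μ * Real.exp (q 1) * pbS μ (q 0),
      fun q => w * (Real.exp (q 1) * pbC μ (q 0) - 1), fun _ => 0, fun _ => 0],
    ![fun _ => 0, fun _ => 0, fun _ => 0, fun _ => 0,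
      fun q => w * μ * q 5, fun q => w * q 4],
    ![fun _ => 0, fun _ => 0, fun _ => 0, fun _ => 0,
      fun q => -(w * q 4), fun q => -(w * q 5)],
    ![fun _ => 0, fun _ => 0, fun _ => 0, fun _ => 0, fun _ => 0, fun _ => 0],
    ![fun _ => 0, fun _ => 0, fun _ => 0, fun _ => 0, fun _ => 0, fun _ => 0]]

/-- The (antisymmetric) Poisson bivector. -/
noncomputable def pbPi (μ w : ℝ) (i j : Fin 6) (q : Fin 6 → ℝ) : ℝ :=
  pbUpper μ w i j q - pbUpper μ w j i q

/-- The Poisson bracket of two smooth functions, extended from the fundamental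
brackets by the Leibniz rule: {F,G}(q) = Σᵢⱼ πᵢⱼ(q) ∂ᵢF(q) ∂ⱼG(q). -/
noncomputable def pbBracket (μ w : ℝ) (F G : (Fin 6 → ℝ) → ℝ) : (Fin 6 → ℝ) → ℝ :=
  fun q => ∑ i : Fin 6, ∑ j : Fin 6,
    pbPi μ w i j q * fderiv ℝ F q (Pi.single i 1) * fderiv ℝ G q (Pi.single j 1)

/-- Coordinate functions. -/
def pbCoord (i : Fin 6) : (Fin 6 → ℝ) → ℝ := fun q => q i

open ContinuousLinearMap in
/-- The differential at `q` of the entry `pbUpper μ w i j`. -/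
noncomputable def pbUpperDeriv (μ w : ℝ) (i j : Fin 6) (q : Fin 6 → ℝ) : (Fin 6 → ℝ) →L[ℝ] ℝ :=
  let dC : (Fin 6 → ℝ) →L[ℝ] ℝ := Real.exp (q 1) •
    ((μ * pbS μ (q 0)) • proj 0 + pbC μ (q 0) • proj 1)
  let dS : (Fin 6 → ℝ) →L[ℝ] ℝ := Real.exp (q 1) •
    (pbC μ (q 0) • proj 0 + pbS μ (q 0) • proj 1)
  (![![0, 0, w • dC, w • dS, 0, 0],
    ![0, 0, (w * μ) • dS, w • dC, 0, 0],
    ![0, 0, 0, 0, (w * μ) • proj 5, w • proj 4],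
    ![0, 0, 0, 0, -(w • proj 4), -(w • proj 5)],
    ![0, 0, 0, 0, 0, 0],
    ![0, 0, 0, 0, 0, 0]] : Fin 6 → Fin 6 → (Fin 6 → ℝ) →L[ℝ] ℝ) i j

theorem hasDerivAt_pbC {μ : ℝ} (hμ : 0 < μ) (θ : ℝ) : HasDerivAt (pbC μ) (μ * pbS μ θ) θ := by
  have h := (Real.hasDerivAt_cosh (√μ * θ)).comp θ ((hasDerivAt_id θ).const_mul √μ)
  refine h.congr_deriv ?_
  have hs : √μ ≠ 0 := (Real.sqrt_pos.2 hμ).ne'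
  rw [pbS]
  field_simp
  rw [Real.sq_sqrt hμ.le, mul_comm]

theorem hasDerivAt_pbS {μ : ℝ} (hμ : 0 < μ) (θ : ℝ) : HasDerivAt (pbS μ) (pbC μ θ) θ := by
  have h := ((Real.hasDerivAt_sinh (√μ * θ)).comp θ
    ((hasDerivAt_id θ).const_mul √μ)).div_const √μ
  refine h.congr_deriv ?_
  have hs : √μ ≠ 0 := (Real.sqrt_pos.2 hμ).ne'
  rw [pbC]
  field_simp

theorem hasFDerivAt_exp_mul {f : ℝ → ℝ} {f' : ℝ} {q : Fin 6 → ℝ} (hf : HasDerivAt f f' (q 0)) :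
    HasFDerivAt (fun x : Fin 6 → ℝ => Real.exp (x 1) * f (x 0))
      (Real.exp (q 1) • (f' • ContinuousLinearMap.proj (R := ℝ) (φ := fun _ : Fin 6 => ℝ) 0
        + f (q 0) • ContinuousLinearMap.proj 1)) q := by
  have h1 := (hasFDerivAt_apply (𝕜 := ℝ) (F' := fun _ : Fin 6 => ℝ) 1 q).exp
  have h0 := hf.comp_hasFDerivAt q (hasFDerivAt_apply (𝕜 := ℝ) (F' := fun _ : Fin 6 => ℝ) 0 q)
  refine (h1.mul h0).congr_fderiv ?_
  ext v
  simp
  ring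

theorem hasFDerivAt_pbUpper {μ : ℝ} (hμ : 0 < μ) (w : ℝ) (i j : Fin 6) (q : Fin 6 → ℝ) :
    HasFDerivAt (pbUpper μ w i j) (pbUpperDeriv μ w i j q) q := by
  have hC := hasFDerivAt_exp_mul (hasDerivAt_pbC hμ (q 0))
  have hS := hasFDerivAt_exp_mul (hasDerivAt_pbS hμ (q 0))
  have hc (k : Fin 6) := hasFDerivAt_apply (𝕜 := ℝ) (F' := fun _ : Fin 6 => ℝ) k q
  fin_cases i <;> fin_cases j <;> first
    | exact hasFDerivAt_const 0 q
    | exact (hC.sub_const 1).const_mul w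
    | exact (hS.const_mul w).congr_of_eventuallyEq (.of_forall fun x => mul_assoc _ _ _)
    | exact (hS.const_mul (w * μ)).congr_of_eventuallyEq (.of_forall fun x => mul_assoc _ _ _)
    | exact (hc _).const_mul (w * μ)
    | exact (hc _).const_mul w
    | exact ((hc _).const_mul w).neg

theorem fderiv_pbCoord (i : Fin 6) (q : Fin 6 → ℝ) :
    fderiv ℝ (pbCoord i) q = ContinuousLinearMap.proj i :=
  (hasFDerivAt_apply i q).fderiv

theorem pbBracket_pbCoord_left (μ w : ℝ) (i : Fin 6) (F : (Fin 6 → ℝ) → ℝ) (q : Fin 6 → ℝ) :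
    pbBracket μ w (pbCoord i) F q = ∑ l, pbPi μ w i l q * fderiv ℝ F q (Pi.single l 1) := by
  simp [pbBracket, fderiv_pbCoord, Pi.single_apply]

theorem pbBracket_pbCoord_pbCoord (μ w : ℝ) (i j : Fin 6) :
    pbBracket μ w (pbCoord i) (pbCoord j) = pbPi μ w i j := by
  ext q
  simp [pbBracket_pbCoord_left, fderiv_pbCoord, Pi.single_apply]

theorem fderiv_pbPi {μ : ℝ} (hμ : 0 < μ) (w : ℝ) (i j : Fin 6) (q : Fin 6 → ℝ) :
    fderiv ℝ (pbPi μ w i j) q = pbUpperDeriv μ w i j q - pbUpperDeriv μ w j i q :=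
  ((hasFDerivAt_pbUpper hμ w i j q).sub (hasFDerivAt_pbUpper hμ w j i q)).fderiv

theorem pbPi_swap (μ w : ℝ) (i j : Fin 6) : pbPi μ w i j = -pbPi μ w j i := by
  ext q
  simp [pbPi]

theorem pbBracket_neg_right (μ w : ℝ) (F G : (Fin 6 → ℝ) → ℝ) :
    pbBracket μ w F (-G) = -pbBracket μ w F G := by
  ext q
  simp [pbBracket, fderiv_neg, Finset.sum_neg_distrib]

/-- The cyclic sum of iterated brackets of three coordinate functions. -/
noncomputable def pbJacobiator (μ w : ℝ) (i j k : Fin 6) (q : Fin 6 → ℝ) : ℝ :=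
  pbBracket μ w (pbCoord i) (pbBracket μ w (pbCoord j) (pbCoord k)) q
    + pbBracket μ w (pbCoord j) (pbBracket μ w (pbCoord k) (pbCoord i)) q
    + pbBracket μ w (pbCoord k) (pbBracket μ w (pbCoord i) (pbCoord j)) q

theorem pbJacobiator_rotate (μ w : ℝ) (i j k : Fin 6) (q : Fin 6 → ℝ) :
    pbJacobiator μ w i j k q = pbJacobiator μ w j k i q := by
  simp only [pbJacobiator]
  ring

theorem pbJacobiator_swap (μ w : ℝ) (i j k : Fin 6) (q : Fin 6 → ℝ) :
    pbJacobiator μ w i j k q = -pbJacobiator μ w j i k q := by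
  simp only [pbJacobiator, pbBracket_pbCoord_pbCoord]
  rw [pbPi_swap μ w j k, pbPi_swap μ w k i, pbPi_swap μ w i j]
  simp only [pbBracket_neg_right, Pi.neg_apply]
  ring

theorem pbJacobiator_eq_zero_of_lt {μ : ℝ} (hμ : 0 < μ) (w : ℝ) {i j k : Fin 6} (hij : i < j)
    (hjk : j < k) (q : Fin 6 → ℝ) : pbJacobiator μ w i j k q = 0 := by
  simp only [pbJacobiator, pbBracket_pbCoord_pbCoord, pbBracket_pbCoord_left, fderiv_pbPi hμ,
    Fin.sum_univ_six]
  fin_cases i <;> fin_cases j <;> first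
    | exact absurd hij (by decide)
    | fin_cases k <;> first
      | exact absurd hjk (by decide)
      | simp [pbPi, pbUpper, pbUpperDeriv] <;> ring

/-- The Sklyanin Poisson bracket on Fun(G_μ) determined by the fundamental
brackets of the paper satisfies the Jacobi identity on all triples of
coordinate functions. -/
theorem poisson_jacobi (μ w : ℝ) (hμ : 0 < μ) :
    ∀ i j k : Fin 6, ∀ q : Fin 6 → ℝ,
      pbBracket μ w (pbCoord i) (pbBracket μ w (pbCoord j) (pbCoord k)) q
        + pbBracket μ w (pbCoord j) (pbBracket μ w (pbCoord k) (pbCoord i)) q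
        + pbBracket μ w (pbCoord k) (pbBracket μ w (pbCoord i) (pbCoord j)) q = 0 := by
  intro i j k q
  change pbJacobiator μ w i j k q = 0
  have hlt (i j k : Fin 6) (hij : i < j) (hjk : j < k) :=
    pbJacobiator_eq_zero_of_lt hμ w hij hjk q
  have hrot (i j k : Fin 6) := pbJacobiator_rotate μ w i j k q
  have hswap (i j k : Fin 6) := pbJacobiator_swap μ w i j k q
  have hself (i k : Fin 6) : pbJacobiator μ w i i k q = 0 := by linarith [hswap i i k]
  rcases lt_trichotomy i j with hij | h | hij <;>
  rcases lt_trichotomy j k with hjk | h' | hjk <;>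
  rcases lt_trichotomy i k with hik | h'' | hik <;> grind
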